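/- Let α₁, α₂, α₃, β be Hermitian 4×4 complex matrices satisfying αⱼαₖ + αₖαⱼ = 2δⱼₖ·1, αⱼβ + βαⱼ = 0 and β² = 1, let m ∈ ℝ, and let ζ : ℝ×ℝ³ → ℂ⁴ be a smooth solution of the free Dirac equation i∂_tζ = −i Σ_{j=1}^3 αⱼ ∂_jζ + m β ζ. Let K := supp ζ(0,·) ⊆ ℝ³. Then ζ(t,x) = 0 whenever dist(x,K) > |t|. In particular a smooth solution of the Dirac equation is uniquely determined by its initial value ζ(0,·), and if ζ(0,·) is compactly supported then the support of ζ is contained in the causal shadow J(K) = {(t,x) : dist(x,K) ≤ |t|}, so ζ is space-compact. -/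

import Mathlib

open Topology

noncomputable section

/-- Physical space `ℝ³`. -/
abbrev Sp3 := EuclideanSpace ℝ (Fin 3)

/-- The `i`-th coordinate direction in `ℝ³`. -/
def sdir (i : Fin 3) : Sp3 := EuclideanSpace.single i 1

section CompactlySupportedSlices

open MeasureTheory Metric

variable {E : Type*} [NormedAddCommGroup E] [NormedSpace ℝ E] [FiniteDimensional ℝ E]
  [MeasurableSpace E] [BorelSpace E] (μ : Measure E) [μ.IsAddHaarMeasure]

/-- A function whose time slices vanish outside balls of locally bounded radius
may be differentiated under the integral sign. -/
lemma hasDerivAt_integral_slice {g : ℝ × E → ℝ} (hg : ContDiff ℝ 1 g) {R : ℝ} {x₀ : E}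
    (hs : ∀ t x, |R - t| ≤ ‖x - x₀‖ → g (t, x) = 0) (t : ℝ) :
    Integrable (fun x => fderiv ℝ g (t, x) (1, 0)) μ ∧
      HasDerivAt (fun r => ∫ x, g (r, x) ∂μ) (∫ x, fderiv ℝ g (t, x) (1, 0) ∂μ) t := by
  have hd : ∀ s x, HasDerivAt (fun r => g (r, x)) (fderiv ℝ g (s, x) (1, 0)) s := fun s x =>
    ((hg.differentiable one_ne_zero (s, x)).hasFDerivAt).comp_hasDerivAt s
      ((hasDerivAt_id s).prodMk (hasDerivAt_const s x))
  have hc : Continuous fun p : ℝ × E => fderiv ℝ g p (1, 0) :=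
    (hg.continuous_fderiv one_ne_zero).clm_apply continuous_const
  obtain ⟨C, hC⟩ := ((isCompact_closedBall t 1).prod
    (isCompact_closedBall x₀ (|R - t| + 2))).exists_bound_of_continuousOn hc.continuousOn
  refine hasDerivAt_integral_of_dominated_loc_of_deriv_le
    (F := fun r x => g (r, x)) (F' := fun r x => fderiv ℝ g (r, x) (1, 0))
    (bound := (closedBall x₀ (|R - t| + 2)).indicator fun _ => C) (ball_mem_nhds t one_pos)
    ?_ ?_ ?_ ?_ ?_ ?_
  · exact .of_forall fun s => (hg.continuous.comp
      (by fun_prop : Continuous fun x : E => (s, x))).aestronglyMeasurable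
  · refine (hg.continuous.comp
      (by fun_prop : Continuous fun x : E => (t, x))).integrable_of_hasCompactSupport ?_
    refine HasCompactSupport.intro (isCompact_closedBall x₀ |R - t|) fun x hx => hs t x ?_
    rw [mem_closedBall, dist_eq_norm] at hx
    exact (not_le.1 hx).le
  · exact (hc.comp (by fun_prop : Continuous fun x : E => (t, x))).aestronglyMeasurable
  · refine .of_forall fun x s hx => ?_
    by_cases hb : x ∈ closedBall x₀ (|R - t| + 2)
    · rw [Set.indicator_of_mem hb]
      exact hC (s, x) ⟨ball_subset_closedBall hx, hb⟩
    · rw [Set.indicator_of_notMem hb]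
      have h0 : (fun r => g (r, x)) =ᶠ[𝓝 s] fun _ => 0 := by
        filter_upwards [ball_mem_nhds s one_pos] with r hr
        apply hs
        rw [mem_closedBall, dist_eq_norm, not_le] at hb
        rw [mem_ball, Real.dist_eq] at hx hr
        have h1 : |R - r| ≤ |R - t| + |t - r| := abs_sub_le _ _ _
        have h2 : |t - r| ≤ |t - s| + |s - r| := abs_sub_le _ _ _
        rw [abs_sub_comm t s, abs_sub_comm s r] at h2
        linarith
      rw [(hd s x).unique ((hasDerivAt_const s (0 : ℝ)).congr_of_eventuallyEq h0), norm_zero]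
  · exact (integrable_indicator_iff measurableSet_closedBall).2
      (integrableOn_const (isCompact_closedBall _ _).measure_lt_top.ne)
  · exact .of_forall fun x s _ => hd s x

/-- The spatial derivatives of a function with compactly supported time slices integrate to
zero over each slice. -/
lemma integral_slice_fderiv_eq_zero {g : ℝ × E → ℝ} (hg : ContDiff ℝ 1 g) {R : ℝ} {x₀ : E}
    (hs : ∀ t x, |R - t| ≤ ‖x - x₀‖ → g (t, x) = 0) (t : ℝ) (v : E) :
    Integrable (fun x => fderiv ℝ g (t, x) (0, v)) μ ∧
      ∫ x, fderiv ℝ g (t, x) (0, v) ∂μ = 0 := by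
  have hgt : ContDiff ℝ 1 fun x => g (t, x) := hg.comp (by fun_prop)
  have hd : ∀ x, fderiv ℝ (fun x => g (t, x)) x v = fderiv ℝ g (t, x) (0, v) := fun x => by
    have h := ((hg.differentiable one_ne_zero (t, x)).hasFDerivAt).comp x
      (hasFDerivAt_prodMk_right t x)
    exact congrArg (fun L => L v) h.fderiv
  have hsupp : HasCompactSupport fun x => g (t, x) := by
    refine HasCompactSupport.intro (isCompact_closedBall x₀ |R - t|) fun x hx => hs t x ?_
    rw [mem_closedBall, dist_eq_norm] at hx
    exact (not_le.1 hx).le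
  have hint : Integrable (fun x => fderiv ℝ (fun x => g (t, x)) x v) μ :=
    ((hgt.continuous_fderiv one_ne_zero).clm_apply
      continuous_const).integrable_of_hasCompactSupport (hsupp.fderiv_apply ℝ v)
  have key := integral_mul_fderiv_eq_neg_fderiv_mul_of_integrable (μ := μ)
    (f := fun _ : E => (1 : ℝ)) (g := fun x => g (t, x)) (v := v) (by simp) (by simpa using hint)
    (by simpa using hgt.continuous.integrable_of_hasCompactSupport hsupp)
    (by fun_prop) (fun x _ => hgt.differentiable one_ne_zero x)
  simp only [hd] at hint key
  exact ⟨hint, by simpa using key⟩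

end CompactlySupportedSlices

section ReForm

open Matrix

variable {n : Type*} [Fintype n]

/-- The real part of the sesquilinear form of a complex matrix, as a real bilinear map. -/
def Matrix.reForm (A : Matrix n n ℂ) : (n → ℂ) →L[ℝ] (n → ℂ) →L[ℝ] ℝ :=
  LinearMap.toContinuousBilinearMap (LinearMap.mk₂ ℝ (fun u v => (star u ⬝ᵥ A *ᵥ v).re)
    (fun _ _ _ => by simp [add_dotProduct])
    (fun _ _ _ => by simp [star_smul, smul_dotProduct])
    (fun _ _ _ => by simp [mulVec_add, dotProduct_add])
    (fun _ _ _ => by simp [mulVec_smul, dotProduct_smul]))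

lemma Matrix.reForm_apply (A : Matrix n n ℂ) (u v : n → ℂ) :
    A.reForm u v = (star u ⬝ᵥ A *ᵥ v).re := rfl

lemma Matrix.IsHermitian.reForm_comm {A : Matrix n n ℂ} (hA : A.IsHermitian) (u v : n → ℂ) :
    A.reForm u v = A.reForm v u := by
  rw [reForm_apply, reForm_apply, star_dotProduct, star_mulVec, hA.eq, ← dotProduct_mulVec]
  simp

lemma Matrix.IsHermitian.reForm_I_smul {A : Matrix n n ℂ} (hA : A.IsHermitian) (v : n → ℂ) :
    A.reForm v (Complex.I • v) = 0 := by
  have h := hA.reForm_comm v (Complex.I • v)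
  simp only [reForm_apply, mulVec_smul, dotProduct_smul, star_smul, smul_dotProduct,
    smul_eq_mul, Complex.star_def, Complex.conj_I, neg_mul, Complex.neg_re] at h ⊢
  linarith

lemma Matrix.reForm_sum_smul {ι : Type*} (s : Finset ι) (c : ι → ℝ) (A : ι → Matrix n n ℂ)
    (u v : n → ℂ) : (∑ j ∈ s, c j • A j).reForm u v = ∑ j ∈ s, c j * (A j).reForm u v := by
  simp [reForm_apply, sum_mulVec, dotProduct_sum, smul_mulVec, dotProduct_smul]

variable [DecidableEq n]

lemma Matrix.reForm_one_mulVec (A : Matrix n n ℂ) (u v : n → ℂ) :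
    (1 : Matrix n n ℂ).reForm u (A *ᵥ v) = A.reForm u v := by
  simp [reForm_apply]

lemma Matrix.reForm_one_self (v : n → ℂ) :
    (1 : Matrix n n ℂ).reForm v v = ∑ i, ‖v i‖ ^ 2 := by
  simp [reForm_apply, dotProduct, ← Complex.normSq_eq_norm_sq, Complex.normSq_apply]

lemma Matrix.reForm_one_self_nonneg (v : n → ℂ) : 0 ≤ (1 : Matrix n n ℂ).reForm v v := by
  rw [reForm_one_self]
  positivity

lemma Matrix.reForm_one_self_eq_zero {v : n → ℂ} (h : (1 : Matrix n n ℂ).reForm v v = 0) :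
    v = 0 := by
  rw [reForm_one_self, Finset.sum_eq_zero_iff_of_nonneg fun i _ => by positivity] at h
  ext i
  simpa using h i (Finset.mem_univ i)

/-- A Hermitian matrix with square `r` is bounded below by `-s` whenever `r ≤ s ^ 2`. -/
lemma Matrix.IsHermitian.reForm_add_nonneg {M : Matrix n n ℂ} (hM : M.IsHermitian) {r s : ℝ}
    (hr : M * M = r • (1 : Matrix n n ℂ)) (hs : 0 < s) (hrs : r ≤ s ^ 2) (v : n → ℂ) :
    0 ≤ s * (1 : Matrix n n ℂ).reForm v v + M.reForm v v := by
  have h := reForm_one_self_nonneg (M *ᵥ v + s • v)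
  have h1 : (1 : Matrix n n ℂ).reForm (M *ᵥ v) (M *ᵥ v)
      = r * (1 : Matrix n n ℂ).reForm v v := by
    rw [reForm_one_mulVec, hM.reForm_comm, ← reForm_one_mulVec, mulVec_mulVec, hr, smul_mulVec,
      one_mulVec, map_smul, smul_eq_mul]
  have h2 : (1 : Matrix n n ℂ).reForm (M *ᵥ v) v = M.reForm v v := by
    rw [isHermitian_one.reForm_comm, reForm_one_mulVec]
  simp only [map_add, map_smul, _root_.add_apply, _root_.smul_apply, smul_eq_mul, h1, h2,
    reForm_one_mulVec] at h
  have hv := reForm_one_self_nonneg v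
  nlinarith [mul_nonneg (sub_nonneg.2 hrs) hv]

end ReForm

section Dirac

open Matrix

lemma clifford_sum_mul_self {α : Fin 3 → Matrix (Fin 4) (Fin 4) ℂ}
    (hαα : ∀ j k, α j * α k + α k * α j
      = if j = k then (2 : ℂ) • (1 : Matrix (Fin 4) (Fin 4) ℂ) else 0) (x : Sp3) :
    (∑ j, x j • α j) * ∑ j, x j • α j = ‖x‖ ^ 2 • (1 : Matrix (Fin 4) (Fin 4) ℂ) := by
  have hd : ∀ j, α j * α j = 1 := fun j => by
    have h := hαα j j
    rw [if_pos rfl, ← two_smul ℂ] at h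
    exact smul_right_injective _ (two_ne_zero' ℂ) h
  have ho : ∀ j k, j ≠ k → α j * α k = -(α k * α j) := fun j k hjk => by
    have h := hαα j k
    rw [if_neg hjk] at h
    exact eq_neg_of_add_eq_zero_left h
  simp only [Fin.sum_univ_three, add_mul, mul_add, smul_mul_smul_comm, hd, ho 1 0 (by decide),
    ho 2 0 (by decide), ho 2 1 (by decide), EuclideanSpace.norm_sq_eq, Real.norm_eq_abs, sq_abs]
  module

/-- The weight localising the energy to the backward cone with apex `(R, x₀)`. -/
def coneWeight (R : ℝ) (x₀ : Sp3) (p : ℝ × Sp3) : ℝ :=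
  expNegInvGlue ((R - p.1) ^ 2 - ‖p.2 - x₀‖ ^ 2)

lemma coneWeight_contDiff (R : ℝ) (x₀ : Sp3) : ContDiff ℝ 1 (coneWeight R x₀) :=
  (expNegInvGlue.contDiff (n := 1)).comp
    (((contDiff_const.sub contDiff_fst).pow 2).sub
      ((contDiff_snd.sub contDiff_const).norm_sq ℝ))

lemma coneWeight_nonneg (R : ℝ) (x₀ : Sp3) (p : ℝ × Sp3) : 0 ≤ coneWeight R x₀ p :=
  expNegInvGlue.nonneg _

lemma coneWeight_eq_zero {R : ℝ} {x₀ : Sp3} {t : ℝ} {x : Sp3} (h : |R - t| ≤ ‖x - x₀‖) :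
    coneWeight R x₀ (t, x) = 0 := by
  refine expNegInvGlue.zero_of_nonpos (sub_nonpos.2 ?_)
  rw [← sq_abs]
  exact pow_le_pow_left₀ (abs_nonneg _) h 2

lemma fderiv_coneWeight (R : ℝ) (x₀ : Sp3) (p v : ℝ × Sp3) :
    fderiv ℝ (coneWeight R x₀) p v = deriv expNegInvGlue ((R - p.1) ^ 2 - ‖p.2 - x₀‖ ^ 2) *
      (-2 * ((R - p.1) * v.1 + inner ℝ (p.2 - x₀) v.2)) := by
  have h1 : HasFDerivAt (fun q : ℝ × Sp3 => (R - q.1) ^ 2 - ‖q.2 - x₀‖ ^ 2) _ p :=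
    ((hasFDerivAt_fst.const_sub R).pow 2).sub ((hasFDerivAt_snd.sub_const x₀).norm_sq)
  have h2 := (((expNegInvGlue.contDiff (n := 1)).differentiable one_ne_zero
    ((R - p.1) ^ 2 - ‖p.2 - x₀‖ ^ 2)).hasDerivAt).comp_hasFDerivAt p h1
  have h3 := congrArg (fun L => L v) h2.fderiv
  refine h3.trans ?_
  simp [inner_sub_left]
  ring

lemma deriv_expNegInvGlue_nonneg (s : ℝ) : 0 ≤ deriv expNegInvGlue s :=
  expNegInvGlue.monotone.deriv_nonneg

lemma deriv_expNegInvGlue_of_nonpos {s : ℝ} (hs : s ≤ 0) : deriv expNegInvGlue s = 0 := by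
  refine IsLocalMin.deriv_eq_zero (.of_forall fun r => ?_)
  rw [expNegInvGlue.zero_of_nonpos hs]
  exact expNegInvGlue.nonneg r

lemma fderiv_weighted_reForm (A : Matrix (Fin 4) (Fin 4) ℂ) (hA : A.IsHermitian)
    {w : ℝ × Sp3 → ℝ} (hw : ContDiff ℝ 1 w) {Z : ℝ × Sp3 → Fin 4 → ℂ} (hZ : ContDiff ℝ 1 Z)
    (p v : ℝ × Sp3) :
    fderiv ℝ (fun p => w p * A.reForm (Z p) (Z p)) p v
      = fderiv ℝ w p v * A.reForm (Z p) (Z p) + 2 * (w p * A.reForm (Z p) (fderiv ℝ Z p v)) := by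
  have hZ' := (hZ.differentiable one_ne_zero p).hasFDerivAt
  have h1 := (hw.differentiable one_ne_zero p).hasFDerivAt.mul
    (A.reForm.hasFDerivAt_of_bilinear hZ' hZ')
  have h2 := congrArg (fun L => L v) h1.fderiv
  refine h2.trans ?_
  simp [hA.reForm_comm (fderiv ℝ Z p v) (Z p)]
  ring

/-- The local energy balance: the spacetime divergence of the weighted current is nonpositive
below the apex of the cone. -/
lemma dirac_divergence_nonpos {α : Fin 3 → Matrix (Fin 4) (Fin 4) ℂ}
    {β : Matrix (Fin 4) (Fin 4) ℂ} (hα : ∀ j, (α j).IsHermitian) (hβ : β.IsHermitian)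
    (hαα : ∀ j k, α j * α k + α k * α j
      = if j = k then (2 : ℂ) • (1 : Matrix (Fin 4) (Fin 4) ℂ) else 0)
    {m : ℝ} {Z : ℝ × Sp3 → Fin 4 → ℂ} (hZ : ContDiff ℝ 1 Z)
    (hD : ∀ p, fderiv ℝ Z p (1, 0)
      = -(∑ j, α j *ᵥ fderiv ℝ Z p (0, sdir j)) - m • Complex.I • β *ᵥ Z p)
    {R : ℝ} (x₀ : Sp3) {p : ℝ × Sp3} (hp : p.1 < R) :
    fderiv ℝ (fun p => coneWeight R x₀ p * (1 : Matrix (Fin 4) (Fin 4) ℂ).reForm (Z p) (Z p))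
        p (1, 0)
      + ∑ j, fderiv ℝ (fun p => coneWeight R x₀ p * (α j).reForm (Z p) (Z p)) p (0, sdir j)
      ≤ 0 := by
  have hw := coneWeight_contDiff R x₀
  have hcancel : (1 : Matrix (Fin 4) (Fin 4) ℂ).reForm (Z p) (fderiv ℝ Z p (1, 0))
      + ∑ j, (α j).reForm (Z p) (fderiv ℝ Z p (0, sdir j)) = 0 := by
    rw [hD]
    simp only [← reForm_one_mulVec (α _), map_sub, map_neg, map_sum, map_smul]
    rw [← mulVec_smul, reForm_one_mulVec, hβ.reForm_I_smul]
    simp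
  have hM : (∑ j, (p.2 - x₀) j • α j).IsHermitian := by
    simp only [Matrix.IsHermitian, conjTranspose_sum, conjTranspose_smul, star_trivial, (hα _).eq]
  have hsum : fderiv ℝ (coneWeight R x₀) p (1, 0) *
        (1 : Matrix (Fin 4) (Fin 4) ℂ).reForm (Z p) (Z p)
      + ∑ j, fderiv ℝ (coneWeight R x₀) p (0, sdir j) * (α j).reForm (Z p) (Z p) ≤ 0 := by
    have heq : fderiv ℝ (coneWeight R x₀) p (1, 0) *
          (1 : Matrix (Fin 4) (Fin 4) ℂ).reForm (Z p) (Z p)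
        + ∑ j, fderiv ℝ (coneWeight R x₀) p (0, sdir j) * (α j).reForm (Z p) (Z p)
        = -2 * (deriv expNegInvGlue ((R - p.1) ^ 2 - ‖p.2 - x₀‖ ^ 2) *
          ((R - p.1) * (1 : Matrix (Fin 4) (Fin 4) ℂ).reForm (Z p) (Z p)
            + (∑ j, (p.2 - x₀) j • α j).reForm (Z p) (Z p))) := by
      rw [reForm_sum_smul]
      simp only [fderiv_coneWeight, sdir, EuclideanSpace.inner_single_right, Fin.sum_univ_three,
        inner_zero_right]
      simp
      ring
    rw [heq]
    rcases le_or_gt ((R - p.1) ^ 2 - ‖p.2 - x₀‖ ^ 2) 0 with h | h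
    · simp [deriv_expNegInvGlue_of_nonpos h]
    · have h1 := hM.reForm_add_nonneg (clifford_sum_mul_self hαα (p.2 - x₀)) (sub_pos.2 hp)
        (sub_nonneg.1 h.le) (Z p)
      have h2 := mul_nonneg (deriv_expNegInvGlue_nonneg ((R - p.1) ^ 2 - ‖p.2 - x₀‖ ^ 2)) h1
      linarith
  rw [fderiv_weighted_reForm _ isHermitian_one hw hZ]
  simp only [fderiv_weighted_reForm _ (hα _) hw hZ, Finset.sum_add_distrib, ← Finset.mul_sum]
  linear_combination hsum + 2 * coneWeight R x₀ p * hcancel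

open MeasureTheory in
/-- A solution of the Dirac equation vanishing initially on a ball vanishes on the forward part
of the light cone over that ball. -/
lemma dirac_eq_zero_of_initial {α : Fin 3 → Matrix (Fin 4) (Fin 4) ℂ}
    {β : Matrix (Fin 4) (Fin 4) ℂ} (hα : ∀ j, (α j).IsHermitian) (hβ : β.IsHermitian)
    (hαα : ∀ j k, α j * α k + α k * α j
      = if j = k then (2 : ℂ) • (1 : Matrix (Fin 4) (Fin 4) ℂ) else 0)
    {m : ℝ} {Z : ℝ × Sp3 → Fin 4 → ℂ} (hZ : ContDiff ℝ 1 Z)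
    (hD : ∀ p, fderiv ℝ Z p (1, 0)
      = -(∑ j, α j *ᵥ fderiv ℝ Z p (0, sdir j)) - m • Complex.I • β *ᵥ Z p)
    {R t : ℝ} {x₀ : Sp3} (h0 : ∀ x, ‖x - x₀‖ < R → Z (0, x) = 0) (ht : 0 ≤ t) (htR : t < R) :
    Z (t, x₀) = 0 := by
  set F : Matrix (Fin 4) (Fin 4) ℂ → ℝ × Sp3 → ℝ := fun A p =>
    coneWeight R x₀ p * A.reForm (Z p) (Z p) with hF
  have hFc : ∀ A, ContDiff ℝ 1 (F A) := fun A =>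
    (coneWeight_contDiff R x₀).mul ((A.reForm.contDiff.comp hZ).clm_apply hZ)
  have hFs : ∀ A r x, |R - r| ≤ ‖x - x₀‖ → F A (r, x) = 0 := fun A r x h => by
    simp [hF, coneWeight_eq_zero h]
  have hFnonneg : ∀ p, 0 ≤ F 1 p := fun p =>
    mul_nonneg (coneWeight_nonneg R x₀ p) (reForm_one_self_nonneg _)
  have hE := fun r => hasDerivAt_integral_slice volume (hFc 1) (hFs 1) r
  have hdiv := fun r j => integral_slice_fderiv_eq_zero volume (hFc (α j)) (hFs (α j)) r (sdir j)
  have hE' : ∀ r < R, ∫ x, fderiv ℝ (F 1) (r, x) (1, 0) ≤ 0 := fun r hr => by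
    have h : ∫ x, (fderiv ℝ (F 1) (r, x) (1, 0) + ∑ j, fderiv ℝ (F (α j)) (r, x) (0, sdir j))
        = ∫ x, fderiv ℝ (F 1) (r, x) (1, 0) := by
      rw [integral_add (hE r).1 (integrable_finsetSum _ fun j _ => (hdiv r j).1),
        integral_finsetSum _ fun j _ => (hdiv r j).1]
      simp [(hdiv r _).2]
    rw [← h]
    exact integral_nonpos fun x => dirac_divergence_nonpos hα hβ hαα hZ hD x₀ hr
  have hanti : AntitoneOn (fun r => ∫ x, F 1 (r, x)) (Set.Icc 0 t) := by
    refine antitoneOn_of_deriv_nonpos (convex_Icc 0 t)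
      (fun r _ => (hE r).2.continuousAt.continuousWithinAt)
      (fun r _ => (hE r).2.differentiableAt.differentiableWithinAt) fun r hr => ?_
    rw [interior_Icc] at hr
    rw [(hE r).2.deriv]
    exact hE' r (hr.2.trans htR)
  have hE0 : ∫ x, F 1 (0, x) = 0 := by
    refine integral_eq_zero_of_ae (.of_forall fun x => ?_)
    rcases lt_or_ge ‖x - x₀‖ R with h | h
    · simp [hF, h0 x h]
    · exact hFs 1 0 x (by rwa [sub_zero, abs_of_pos (ht.trans_lt htR)])
  have hEt : ∫ x, F 1 (t, x) ≤ 0 :=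
    (hanti (Set.left_mem_Icc.2 ht) (Set.right_mem_Icc.2 ht) ht).trans hE0.le
  have hzero : F 1 (t, x₀) = 0 := by
    by_contra hne
    refine hEt.not_gt (Continuous.integral_pos_of_hasCompactSupport_nonneg_nonzero (x := x₀)
      ((hFc 1).continuous.comp (by fun_prop)) ?_ (fun x => hFnonneg (t, x)) hne)
    refine HasCompactSupport.intro (isCompact_closedBall x₀ |R - t|) fun x hx => hFs 1 t x ?_
    rw [Metric.mem_closedBall, dist_eq_norm] at hx
    exact (not_le.1 hx).le
  have hwpos : coneWeight R x₀ (t, x₀) ≠ 0 :=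
    (expNegInvGlue.pos_of_pos (by simpa using pow_pos (sub_pos.2 htR) 2)).ne'
  exact reForm_one_self_eq_zero ((mul_eq_zero.1 hzero).resolve_left hwpos)

end Dirac

/-- Finite propagation speed for the Dirac equation: a smooth solution vanishes
outside the causal shadow of the support of its initial value. -/
theorem stmt_11
    (α : Fin 3 → Matrix (Fin 4) (Fin 4) ℂ) (β : Matrix (Fin 4) (Fin 4) ℂ)
    (hαherm : ∀ j, (α j).IsHermitian) (hβherm : β.IsHermitian)
    (hαα : ∀ j k, α j * α k + α k * α j
      = if j = k then (2 : ℂ) • (1 : Matrix (Fin 4) (Fin 4) ℂ) else 0)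
    (hαβ : ∀ j, α j * β + β * α j = 0)
    (hβ2 : β * β = 1)
    (m : ℝ) (ζ : ℝ → Sp3 → (Fin 4 → ℂ))
    (hsmooth : ContDiff ℝ (⊤ : ℕ∞) (fun p : ℝ × Sp3 => ζ p.1 p.2))
    (hDirac : ∀ (t : ℝ) (x : Sp3),
      Complex.I • deriv (fun r => ζ r x) t
        = -(Complex.I • ∑ j, (α j).mulVec (fderiv ℝ (fun y => ζ t y) x (sdir j)))
          + (m : ℂ) • β.mulVec (ζ t x))
    (K : Set Sp3) (hK : K = Function.support (fun x => ζ 0 x)) :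
    ∀ (t : ℝ) (x : Sp3), ENNReal.ofReal |t| < EMetric.infEdist x K → ζ t x = 0 := by
  intro t x₀ hlt
  obtain ⟨R, hR0, htR, hRK⟩ := ENNReal.lt_iff_exists_real_btwn.1 hlt
  have htR' : |t| < R := (ENNReal.ofReal_lt_ofReal_iff_of_nonneg (abs_nonneg t)).1 htR
  have h0 : ∀ x, ‖x - x₀‖ < R → ζ 0 x = 0 := fun x hx => by
    by_contra hne
    have hxK : x ∈ K := hK ▸ hne
    refine (Metric.infEDist_le_edist_of_mem (x := x₀) hxK).not_gt (lt_of_le_of_lt ?_ hRK)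
    rw [edist_comm, edist_dist, dist_eq_norm]
    exact ENNReal.ofReal_le_ofReal hx.le
  set Z : ℝ × Sp3 → Fin 4 → ℂ := fun p => ζ p.1 p.2 with hZdef
  have hZ : ContDiff ℝ 1 Z := hsmooth.of_le (by exact_mod_cast le_top)
  have hZd : ∀ p, HasFDerivAt Z (fderiv ℝ Z p) p := fun p =>
    (hZ.differentiable one_ne_zero p).hasFDerivAt
  have hD : ∀ p, fderiv ℝ Z p (1, 0)
      = -(∑ j, (α j).mulVec (fderiv ℝ Z p (0, sdir j))) - m • Complex.I • β.mulVec (Z p) := by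
    rintro ⟨s, x⟩
    have h1 : HasDerivAt (fun r => ζ r x) (fderiv ℝ Z (s, x) (1, 0)) s :=
      HasFDerivAt.comp_hasDerivAt (l := Z) (f := fun r => (r, x)) s (hZd (s, x))
        ((hasDerivAt_id s).prodMk (hasDerivAt_const s x))
    have h2 : ∀ v, fderiv ℝ (fun y => ζ s y) x v = fderiv ℝ Z (s, x) (0, v) := fun v =>
      congrArg (fun L => L v) ((hZd (s, x)).comp x (hasFDerivAt_prodMk_right s x)).fderiv
    have h3 := congrArg (fun u => (-Complex.I) • u) (hDirac s x)
    simp only [h1.deriv, h2, smul_add, smul_neg, smul_smul] at h3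
    simp only [neg_mul, Complex.I_mul_I, neg_neg, one_smul, neg_smul] at h3
    rw [h3, sub_eq_add_neg, ← Complex.coe_smul m, smul_smul, mul_comm (m : ℂ)]
  rcases le_total 0 t with ht | ht
  · exact dirac_eq_zero_of_initial hαherm hβherm hαα hZ hD h0 ht ((le_abs_self t).trans_lt htR')
  · have hrefl : ∀ p : ℝ × Sp3, HasFDerivAt (fun p : ℝ × Sp3 => Z (-p.1, p.2))
        ((fderiv ℝ Z (-p.1, p.2)).comp ((-ContinuousLinearMap.fst ℝ ℝ Sp3).prod
          (ContinuousLinearMap.snd ℝ ℝ Sp3))) p := fun p =>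
      HasFDerivAt.comp (g := Z) (f := fun p : ℝ × Sp3 => (-p.1, p.2)) p (hZd (-p.1, p.2))
        (hasFDerivAt_fst.neg.prodMk hasFDerivAt_snd)
    have h := dirac_eq_zero_of_initial (α := fun j => -α j) (β := β) (m := -m)
      (Z := fun p => Z (-p.1, p.2)) (R := R) (t := -t) (x₀ := x₀) (fun j => (hαherm j).neg) hβherm
      (by simpa using hαα) (hZ.comp (contDiff_fst.neg.prodMk contDiff_snd)) (fun p => ?_)
      (by simpa [hZdef] using h0) (neg_nonneg.2 ht) ((neg_le_abs t).trans_lt htR')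
    · simpa [hZdef] using h
    · have hneg : fderiv ℝ Z (-p.1, p.2) (-1, 0) = -fderiv ℝ Z (-p.1, p.2) (1, 0) := by
        rw [← map_neg]
        simp
      simp [(hrefl p).fderiv, hneg, hD, Matrix.neg_mulVec]
      exact add_comm _ _

end
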